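/- arXiv:1806.08291 — 2 statements merged into one kernel-verified Lean document; each statement's English description precedes it below -/
import Mathlib

section
/- Let G be a spider with body v, and let I and J be independent sets of G with |I| = |J| such that I ↭ J, no token of I is (G,I)-rigid, and no token of J is (G,J)-rigid. Suppose that 0 < max{|I ∩ N(v)|, |J ∩ N(v)|} ≤ 1 and that some leg of G satisfies |I_L| ≠ |J_L|. Suppose further that it is NOT the case that I ∩ N(v) = {x} and J ∩ N(v) = {y} with x and y lying in the same leg L of G with |I_L| = |J_L|. Then there exists a TS-sequence between I and J of length exactly M*(G,I,J). -/
/-!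
Common definitions for formalizing "Shortest Reconfiguration Sequence for
Sliding Tokens on Spiders" (Hoang, Khorramian, Uehara).
-/

namespace SlidingTokenPaper

variable {V : Type*} [Fintype V] [DecidableEq V]

/-- A finite vertex set is independent in `G`. -/
def IsIndep (G : SimpleGraph V) (I : Finset V) : Prop :=
  ∀ x ∈ I, ∀ y ∈ I, ¬ G.Adj x y

/-- One token slide: a token moves from `x` to `y` along an edge `xy`. -/
def Step (G : SimpleGraph V) (A B : Finset V) : Prop :=
  ∃ x y : V, G.Adj x y ∧ A \ B = {x} ∧ B \ A = {y}

/-- `S` is a TS-sequence between the independent sets `I` and `J` of `G`. -/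
def IsTSSeq (G : SimpleGraph V) (I J : Finset V) (S : List (Finset V)) : Prop :=
  S ≠ [] ∧ S.head? = some I ∧ S.getLast? = some J ∧
  (∀ A ∈ S, IsIndep G A ∧ A.card = I.card) ∧ List.Chain' (Step G) S

/-- The length of a TS-sequence: number of token slides. -/
def len (S : List (Finset V)) : ℕ := S.length - 1

/-- `I ↭ J`: there is a TS-sequence between `I` and `J`. -/
def Reconf (G : SimpleGraph V) (I J : Finset V) : Prop :=
  ∃ S, IsTSSeq G I J S

/-- `M*(G,I,J)`: the minimum over all bijections (target assignments)
`f : I → J` of `∑_{w ∈ I} dist_G(w, f(w))`. -/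
noncomputable def Mstar (G : SimpleGraph V) (I J : Finset V) : ℕ :=
  sInf { m : ℕ | ∃ e : {x // x ∈ I} ≃ {y // y ∈ J},
    m = ∑ x : {x // x ∈ I}, G.dist (x : V) ((e x : V)) }

/-- The number of occurrences of the move `x → y` in `S`. -/
def moveCount (S : List (Finset V)) (x y : V) : ℕ :=
  ((S.zip S.tail).filter fun p => p.1 \ p.2 = {x} ∧ p.2 \ p.1 = {y}).length

/-- `D_G(S, e)`: twice the minimum of the numbers of occurrences of the moves
`x → y` and `y → x` in `S`, where `e = xy`. -/
def detours (S : List (Finset V)) : Sym2 V → ℕ :=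
  Sym2.lift ⟨fun x y => 2 * min (moveCount S x y) (moveCount S y x),
    fun x y => by dsimp only; rw [min_comm]⟩

open scoped Classical in
/-- `D_G(S)`: the total number of detours `S` makes, summed over the edges. -/
noncomputable def totalDetours (G : SimpleGraph V) (S : List (Finset V)) : ℕ :=
  ∑ e ∈ Finset.univ.filter (· ∈ G.edgeSet), detours S e

/-- `D*(G,I,J)`: the minimum number of detours of a TS-sequence between `I` and `J`. -/
noncomputable def Dstar (G : SimpleGraph V) (I J : Finset V) : ℕ :=
  sInf { d : ℕ | ∃ S, IsTSSeq G I J S ∧ d = totalDetours G S }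

/-- The token on `u ∈ I` is `(G, I)`-rigid: `u` belongs to every independent set
reachable from `I`. -/
def RigidToken (G : SimpleGraph V) (I : Finset V) (u : V) : Prop :=
  ∀ I', Reconf G I I' → u ∈ I'

/-- `G` is a spider with body `v`: a tree with exactly one vertex of degree ≥ 3. -/
def IsSpider (G : SimpleGraph V) (v : V) : Prop :=
  G.IsTree ∧ 3 ≤ (G.neighborSet v).ncard ∧ ∀ w, 3 ≤ (G.neighborSet w).ncard → w = v

/-- For adjacent `x, y` in a tree `T`, `side T x y` is the vertex set of `T^x_y`,
the component of `T − xy` containing `y` (vertices strictly closer to `y` than to `x`). -/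
def side (G : SimpleGraph V) (x y : V) : Set V :=
  {z | G.dist z y < G.dist z x}

/-- `|I ∩ V(L)|` for the leg `L` of the spider with body `v` containing the
neighbor `w` of `v`. -/
noncomputable def legCard (G : SimpleGraph V) (I : Finset V) (v w : V) : ℕ :=
  ((I : Set V) ∩ side G v w).ncard

/-- `|I ∩ V(L)| − |J ∩ V(L)|` for the leg `L` of the spider indexed by the
neighbor `w` of the body `v`. -/
noncomputable def legDiff (G : SimpleGraph V) (I J : Finset V) (v w : V) : ℤ :=
  (legCard G I v w : ℤ) - (legCard G J v w : ℤ)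

/-- The leg indexed by the neighbor `w₁` of `v` may serve as `L_1` in a labeling
of the legs making `|I∩V(L_i)| − |J∩V(L_i)|` nondecreasing, i.e. it minimizes the
difference. -/
def IsFirstLeg (G : SimpleGraph V) (I J : Finset V) (v w₁ : V) : Prop :=
  G.Adj v w₁ ∧ ∀ w, G.Adj v w → legDiff G I J v w₁ ≤ legDiff G I J v w

/-- `I_L` for the leg `L` indexed by the neighbor `w` of the body `v`, where the
first leg (indexed by `w₁`) additionally receives `I ∩ {v}`. -/
noncomputable def ILeg (G : SimpleGraph V) (I : Finset V) (v w₁ w : V) : Set V :=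
  ((I : Set V) ∩ side G v w) ∪ (if w = w₁ then (I : Set V) ∩ {v} else ∅)

/-- `|I_L|` for the leg `L` indexed by the neighbor `w` of the body `v`. -/
noncomputable def ILegCard (G : SimpleGraph V) (I : Finset V) (v w₁ w : V) : ℕ :=
  (ILeg G I v w₁ w).ncard

/-- `S` makes a detour over the edge `ab`: both moves `a → b` and `b → a` occur in `S`. -/
def MakesDetour (S : List (Finset V)) (a b : V) : Prop :=
  0 < moveCount S a b ∧ 0 < moveCount S b a


open scoped Classical in
/-- The neighbors of `p` that are farther from the root `v` than `p`. -/
noncomputable def children (G : SimpleGraph V) (v p : V) : Finset V :=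
  Finset.univ.filter fun c => G.Adj p c ∧ G.dist v c = G.dist v p + 1

/-- The vertices lying on a geodesic from the root `v` to `u`. -/
noncomputable def ancestors (G : SimpleGraph V) (v u : V) : Finset V :=
  Finset.univ.filter fun z => G.dist v u = G.dist v z + G.dist z u

/-- The number of tokens of `I` at or below `z`, with respect to the root `v`. -/
noncomputable def load (G : SimpleGraph V) (v : V) (I : Finset V) (z : V) : ℤ :=
  ∑ u ∈ I, if z ∈ ancestors G v u then 1 else 0

/-- The net number of tokens that must cross the edge from `z` towards the root `v`. -/
noncomputable def flow (G : SimpleGraph V) (v : V) (I J : Finset V) (z : V) : ℤ :=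
  load G v I z - load G v J z

/-- The total absolute flow over all edges. -/
noncomputable def potential (G : SimpleGraph V) (v : V) (I J : Finset V) : ℕ :=
  ∑ z, (flow G v I J z).natAbs

section Tree

set_option linter.unusedSectionVars false

variable {G : SimpleGraph V} {v p q c u : V}

lemma mem_children : c ∈ children G v p ↔ G.Adj p c ∧ G.dist v c = G.dist v p + 1 := by
  simp [children]

lemma mem_ancestors : c ∈ ancestors G v u ↔ G.dist v u = G.dist v c + G.dist c u := by
  simp [ancestors]

lemma mem_children_root : c ∈ children G v v ↔ G.Adj v c := by
  rw [mem_children, SimpleGraph.dist_self, and_iff_left_iff_imp]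
  exact fun h => by simpa using h

lemma ne_root_of_mem_children (h : c ∈ children G v p) : c ≠ v := by
  rintro rfl
  have := (mem_children.1 h).2
  simp at this

lemma parent_unique (hT : G.IsTree) (hp : c ∈ children G v p) (hq : c ∈ children G v q) :
    p = q := by
  rw [mem_children] at hp hq
  obtain ⟨P, -, hPl⟩ := hT.connected.exists_path_of_dist v p
  obtain ⟨Q, -, hQl⟩ := hT.connected.exists_path_of_dist v q
  have hP : (P.concat hp.1).IsPath :=
    SimpleGraph.Walk.isPath_of_length_eq_dist _ (by simp [hPl, hp.2])
  have hQ : (Q.concat hq.1).IsPath :=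
    SimpleGraph.Walk.isPath_of_length_eq_dist _ (by simp [hQl, hq.2])
  exact (SimpleGraph.Walk.concat_inj ((hT.existsUnique_path v c).unique hP hQ)).1

lemma exists_adj_dist_succ (hG : G.Connected) (h : u ≠ v) :
    ∃ q, G.Adj q u ∧ G.dist v u = G.dist v q + 1 := by
  obtain ⟨W, hW⟩ := hG.exists_walk_length_eq_dist u v
  cases W with
  | nil => exact absurd rfl h
  | @cons _ q _ hadj W' =>
    refine ⟨q, hadj.symm, ?_⟩
    have h1 := SimpleGraph.dist_le W'
    have h2 : G.dist v u ≤ G.dist v q + G.dist q u := hG.dist_triangle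
    rw [SimpleGraph.dist_eq_one_iff_adj.2 hadj.symm] at h2
    rw [SimpleGraph.Walk.length_cons, SimpleGraph.dist_comm] at hW
    rw [SimpleGraph.dist_comm] at h1
    omega

lemma exists_parent (hG : G.Connected) (h : u ≠ v) : ∃ p, u ∈ children G v p := by
  obtain ⟨q, hq⟩ := exists_adj_dist_succ hG h
  exact ⟨q, mem_children.2 hq⟩

lemma mem_children_or_mem_children (hT : G.IsTree) (v : V) (h : G.Adj p q) :
    q ∈ children G v p ∨ p ∈ children G v q := by
  rw [mem_children, mem_children]
  rcases hT.dist_eq_dist_add_one_of_adj v h with h' | h'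
  · exact Or.inr ⟨h.symm, h'⟩
  · exact Or.inl ⟨h, h'⟩

lemma depth_induction (hG : G.Connected) {P : V → Prop} (root : P v)
    (step : ∀ p, ∀ c ∈ children G v p, P p → P c) (u : V) : P u := by
  induction h : G.dist v u generalizing u with
  | zero => rw [hG.dist_eq_zero_iff] at h; exact h ▸ root
  | succ n ih =>
    obtain ⟨p, hp⟩ := exists_parent hG (u := u) (v := v) (by rintro rfl; simp at h)
    exact step p u hp (ih p (by have := (mem_children.1 hp).2; omega))

lemma ancestors_root (hG : G.Connected) : ancestors G v v = {v} := by
  ext z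
  rw [mem_ancestors, Finset.mem_singleton, SimpleGraph.dist_self, eq_comm (a := z),
    ← hG.dist_eq_zero_iff]
  rw [SimpleGraph.dist_comm (u := z)]
  omega

lemma ancestors_child (hT : G.IsTree) (h : c ∈ children G v p) :
    ancestors G v c = insert c (ancestors G v p) := by
  have hG := hT.connected
  obtain ⟨hadj, hd⟩ := mem_children.1 h
  ext z
  rw [Finset.mem_insert, mem_ancestors, mem_ancestors]
  constructor
  · intro hz
    by_cases hzc : z = c
    · exact Or.inl hzc
    refine Or.inr ?_
    obtain ⟨q, hq, hq'⟩ := exists_adj_dist_succ hG (Ne.symm hzc)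
    have h1 : G.dist v q ≤ G.dist v z + G.dist z q := hG.dist_triangle
    have h2 : G.dist v c ≤ G.dist v q + G.dist q c := hG.dist_triangle
    rw [SimpleGraph.dist_eq_one_iff_adj.2 hq] at h2
    have hqp : q = p := parent_unique hT (mem_children.2 ⟨hq, by omega⟩) h
    subst hqp
    omega
  · rintro (rfl | hz)
    · simp
    have h1 : G.dist v c ≤ G.dist v z + G.dist z c := hG.dist_triangle
    have h2 : G.dist z c ≤ G.dist z p + G.dist p c := hG.dist_triangle
    rw [SimpleGraph.dist_eq_one_iff_adj.2 hadj] at h2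
    omega

lemma not_mem_ancestors_of_mem_children (h : c ∈ children G v p) : c ∉ ancestors G v p := by
  rw [mem_ancestors]
  have := (mem_children.1 h).2
  omega

lemma indicator_ancestors (hT : G.IsTree) (p u : V) :
    (if p ∈ ancestors G v u then (1 : ℤ) else 0) = (if u = p then 1 else 0) +
      ∑ c ∈ children G v p, if c ∈ ancestors G v u then 1 else 0 := by
  induction u using depth_induction (v := v) hT.connected with
  | root =>
    rw [ancestors_root hT.connected, Finset.sum_eq_zero]
    · simp [eq_comm]
    · intro c hc
      simp [ne_root_of_mem_children hc]
  | step q d hd ih =>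
    have key : ∀ z, (if z ∈ ancestors G v d then (1 : ℤ) else 0) =
        (if z = d then 1 else 0) + if z ∈ ancestors G v q then 1 else 0 := by
      intro z
      have := not_mem_ancestors_of_mem_children hd
      rw [ancestors_child hT hd]
      by_cases h : z = d <;> simp [h, this]
    simp_rw [key, Finset.sum_add_distrib, Finset.sum_ite_eq', ih]
    by_cases hpq : q = p
    · subst hpq; simp [hd, eq_comm]
    · have : d ∉ children G v p := fun h => hpq (parent_unique hT hd h)
      simp [hpq, this, eq_comm]

lemma load_eq (hT : G.IsTree) (I : Finset V) (p : V) :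
    load G v I p = (if p ∈ I then 1 else 0) + ∑ c ∈ children G v p, load G v I c := by
  unfold load
  rw [Finset.sum_comm, Finset.sum_congr rfl fun u _ => indicator_ancestors hT p u,
    Finset.sum_add_distrib]
  simp

lemma flow_eq (hT : G.IsTree) (I J : Finset V) (p : V) :
    flow G v I J p = (if p ∈ I then 1 else 0) - (if p ∈ J then 1 else 0) +
      ∑ c ∈ children G v p, flow G v I J c := by
  unfold flow
  rw [load_eq hT, load_eq hT J, Finset.sum_sub_distrib]
  ring

lemma load_root (I : Finset V) : load G v I v = I.card := by
  simp [load, mem_ancestors]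

lemma flow_root {I J : Finset V} (h : I.card = J.card) :
    flow G v I J v = 0 := by
  simp [flow, load_root, h]

lemma flow_swap (I J : Finset V) (z : V) : flow G v J I z = -flow G v I J z := by
  simp [flow]

lemma potential_comm (I J : Finset V) : potential G v J I = potential G v I J := by
  simp only [potential, flow_swap I J, Int.natAbs_neg]

lemma eq_of_potential_eq_zero (hT : G.IsTree) {I J : Finset V} (h : potential G v I J = 0) :
    I = J := by
  have h0 : ∀ z, flow G v I J z = 0 := by simpa [potential] using h
  ext z
  have := flow_eq (v := v) hT I J z
  simp only [h0, Finset.sum_const_zero] at this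
  by_cases h1 : z ∈ I <;> by_cases h2 : z ∈ J <;> simp [h1, h2] at this ⊢

lemma load_slide (I : Finset V) {a b : V} (ha : a ∈ I) (hb : b ∉ I) (z : V) :
    load G v (insert b (I.erase a)) z = load G v I z +
      ((if z ∈ ancestors G v b then 1 else 0) - if z ∈ ancestors G v a then 1 else 0) := by
  unfold load
  rw [Finset.sum_insert (by simp [hb]), ← Finset.add_sum_erase I _ ha]
  ring

lemma flow_slide_down (hT : G.IsTree) (I J : Finset V) (h : c ∈ children G v p) (hp : p ∈ I)
    (hc : c ∉ I) (z : V) :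
    flow G v (insert c (I.erase p)) J z = flow G v I J z + if z = c then 1 else 0 := by
  have := not_mem_ancestors_of_mem_children h
  rw [flow, load_slide I hp hc, ancestors_child hT h, flow]
  by_cases hz : z = c
  · subst hz; simp [this]; ring
  · simp [hz]

lemma flow_slide_up (hT : G.IsTree) (I J : Finset V) (h : c ∈ children G v p) (hp : p ∉ I)
    (hc : c ∈ I) (z : V) :
    flow G v (insert p (I.erase c)) J z = flow G v I J z - if z = c then 1 else 0 := by
  have := not_mem_ancestors_of_mem_children h
  rw [flow, load_slide I hc hp, ancestors_child hT h, flow]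
  by_cases hz : z = c
  · subst hz; simp [this]; ring
  · simp [hz]

lemma sum_abs_indicator_le (hT : G.IsTree) (a b : V) :
    ∑ z, |(if z ∈ ancestors G v a then (1 : ℤ) else 0) - if z ∈ ancestors G v b then 1 else 0|
      ≤ G.dist a b := by
  have hchild : ∀ {p c : V}, c ∈ children G v p →
      ∑ z, |(if z ∈ ancestors G v c then (1 : ℤ) else 0) -
        if z ∈ ancestors G v p then 1 else 0| = 1 := by
    intro p c h
    have hn := not_mem_ancestors_of_mem_children h
    rw [Finset.sum_eq_single c]
    · simp [ancestors_child hT h, hn]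
    · intro z _ hz
      simp [ancestors_child hT h, hz]
    · simp
  obtain ⟨W, hW⟩ := hT.connected.exists_walk_length_eq_dist a b
  rw [← hW]
  clear hW
  induction W with
  | nil => simp
  | @cons a d b hadj W ih =>
    have h1 : ∑ z, |(if z ∈ ancestors G v a then (1 : ℤ) else 0) -
        if z ∈ ancestors G v d then 1 else 0| = 1 := by
      rcases mem_children_or_mem_children hT v hadj with h | h
      · simp_rw [abs_sub_comm (if _ ∈ ancestors G v a then (1 : ℤ) else 0)]
        exact hchild h
      · exact hchild h
    calc _ ≤ ∑ z, (|(if z ∈ ancestors G v a then (1 : ℤ) else 0) -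
          if z ∈ ancestors G v d then 1 else 0| +
          |(if z ∈ ancestors G v d then (1 : ℤ) else 0) -
          if z ∈ ancestors G v b then 1 else 0|) :=
          Finset.sum_le_sum fun z _ => abs_sub_le _ _ _
      _ ≤ _ := by
          rw [Finset.sum_add_distrib, h1, SimpleGraph.Walk.length_cons]
          push_cast
          linarith

lemma potential_le_sum_dist (hT : G.IsTree) {I J : Finset V}
    (e : {x // x ∈ I} ≃ {y // y ∈ J}) :
    potential G v I J ≤ ∑ x : {x // x ∈ I}, G.dist (x : V) (e x : V) := by
  have hflow : ∀ z, flow G v I J z = ∑ x : {x // x ∈ I},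
      ((if z ∈ ancestors G v (x : V) then (1 : ℤ) else 0) -
        if z ∈ ancestors G v (e x : V) then 1 else 0) := by
    intro z
    rw [Finset.sum_sub_distrib,
      e.sum_comp (fun y : {y // y ∈ J} => if z ∈ ancestors G v (y : V) then (1 : ℤ) else 0),
      flow, load, load, ← Finset.sum_coe_sort I, ← Finset.sum_coe_sort J]
  zify
  unfold potential
  push_cast
  calc _ ≤ ∑ z, ∑ x : {x // x ∈ I},
      |(if z ∈ ancestors G v (x : V) then (1 : ℤ) else 0) -
        if z ∈ ancestors G v (e x : V) then 1 else 0| := by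
        refine Finset.sum_le_sum fun z _ => ?_
        rw [hflow]
        exact Finset.abs_sum_le_sum_abs _ _
    _ ≤ _ := by
        rw [Finset.sum_comm]
        exact Finset.sum_le_sum fun x _ => sum_abs_indicator_le hT _ _

end Tree

section Sequences

set_option linter.unusedSectionVars false

variable {G : SimpleGraph V} {I J K : Finset V}

/-- `K` arises from `I` by sliding the token on `a` to the free neighbor `b`. -/
def Slide (G : SimpleGraph V) (I K : Finset V) : Prop :=
  ∃ a ∈ I, ∃ b ∉ I, G.Adj a b ∧ K = insert b (I.erase a)

lemma Step.slide (h : Step G I K) : Slide G I K := by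
  obtain ⟨a, b, hab, h1, h2⟩ := h
  have ha : a ∈ I \ K := by simp [h1]
  have hb : b ∈ K \ I := by simp [h2]
  rw [Finset.mem_sdiff] at ha hb
  refine ⟨a, ha.1, b, hb.2, hab, ?_⟩
  ext z
  have e1 : z ∈ I \ K ↔ z = a := by simp [h1]
  have e2 : z ∈ K \ I ↔ z = b := by simp [h2]
  rw [Finset.mem_sdiff] at e1 e2
  rw [Finset.mem_insert, Finset.mem_erase]
  tauto

lemma Slide.step (h : Slide G I K) : Step G I K := by
  obtain ⟨a, ha, b, hb, hab, rfl⟩ := h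
  have hne : a ≠ b := hab.ne
  refine ⟨a, b, hab, ?_, ?_⟩
  · ext z
    by_cases hz : z = a
    · subst hz; simp [ha, hne]
    · simp +contextual [hz]
  · ext z
    by_cases hz : z = b
    · subst hz; simp [hb]
    · simp +contextual [hz]

lemma Slide.symm (h : Slide G I K) : Slide G K I := by
  obtain ⟨a, ha, b, hb, hab, rfl⟩ := h
  refine ⟨b, by simp, a, by simp [hab.ne], hab.symm, ?_⟩
  ext z
  by_cases hz : z = a
  · subst hz; simp [ha]
  by_cases hz' : z = b
  · subst hz'; simp [hb, hz]
  · simp [hz, hz']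

lemma Slide.card_eq (h : Slide G I K) : K.card = I.card := by
  obtain ⟨a, ha, b, hb, hab, rfl⟩ := h
  rw [Finset.card_insert_of_notMem (by simp [hb]), Finset.card_erase_add_one ha]

/-- `J` can be reached from `I` by a TS-sequence of length `n`. -/
def ReconfIn (G : SimpleGraph V) (n : ℕ) (I J : Finset V) : Prop :=
  ∃ S, IsTSSeq G I J S ∧ len S = n

lemma ReconfIn.refl (hI : IsIndep G I) : ReconfIn G 0 I I :=
  ⟨[I], ⟨by simp, by simp, by simp, by simpa using hI, List.isChain_singleton _⟩, rfl⟩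

lemma ReconfIn.cons {n : ℕ} (hI : IsIndep G I) (h : Slide G I K) (hK : ReconfIn G n K J) :
    ReconfIn G (n + 1) I J := by
  obtain ⟨S, ⟨hne, hhead, hlast, hmem, hchain⟩, hlen⟩ := hK
  obtain ⟨A, T, rfl⟩ := List.exists_cons_of_ne_nil hne
  obtain rfl : A = K := by simpa using hhead
  refine ⟨I :: A :: T, ⟨by simp, by simp, by simpa using hlast, ?_, ?_⟩, ?_⟩
  · intro B hB
    rcases List.mem_cons.1 hB with rfl | hB
    · exact ⟨hI, rfl⟩
    · exact ⟨(hmem B hB).1, (hmem B hB).2.trans h.card_eq⟩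
  · exact List.IsChain.cons_cons h.step hchain
  · simp only [len, List.length_cons] at hlen ⊢
    omega

lemma ReconfIn.concat {n : ℕ} (hJ : IsIndep G J) (hK : ReconfIn G n I K) (h : Slide G K J) :
    ReconfIn G (n + 1) I J := by
  obtain ⟨S, ⟨hne, hhead, hlast, hmem, hchain⟩, hlen⟩ := hK
  have hKmem : K ∈ S := List.mem_of_getLast? hlast
  refine ⟨S ++ [J], ⟨by simp, by simp [hhead], by simp, ?_, ?_⟩, ?_⟩
  · intro B hB
    rcases List.mem_append.1 hB with hB | hB
    · exact hmem B hB
    · obtain rfl : B = J := by simpa using hB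
      exact ⟨hJ, h.card_eq.trans (hmem K hKmem).2⟩
  · refine List.IsChain.append hchain (List.isChain_singleton _) ?_
    intro x hx y hy
    obtain rfl : K = x := by simpa [hlast] using hx
    obtain rfl : J = y := by simpa using hy
    exact h.step
  · have : 0 < S.length := List.length_pos_of_ne_nil hne
    simp only [len, List.length_append, List.length_singleton] at hlen ⊢
    omega

lemma exists_perm_of_isChain (hG : G.Connected) {S : List (Finset V)}
    (hS : S.IsChain (Step G)) (hI : S.head? = some I) (hJ : S.getLast? = some J) :
    ∃ σ : Equiv.Perm V, (∀ x, x ∈ I ↔ σ x ∈ J) ∧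
      ∑ x ∈ I, G.dist x (σ x) ≤ S.length - 1 := by
  induction S generalizing I with
  | nil => simp at hI
  | cons A T ih =>
    obtain rfl : A = I := by simpa using hI
    cases T with
    | nil =>
      obtain rfl : A = J := by simpa using hJ
      exact ⟨1, by simp, by simp⟩
    | cons B T =>
      rw [List.isChain_cons_cons] at hS
      obtain ⟨σ, hσ, hsum⟩ := ih hS.2 (I := B) (by simp) (by simpa using hJ)
      obtain ⟨a, ha, b, hb, hab, rfl⟩ := hS.1.slide
      refine ⟨(Equiv.swap a b).trans σ, fun x => ?_, ?_⟩
      · rw [Equiv.trans_apply, ← hσ]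
        by_cases hxa : x = a
        · subst hxa; simp [ha]
        by_cases hxb : x = b
        · subst hxb; simp [hb, hab.ne]
        · simp [Equiv.swap_apply_of_ne_of_ne hxa hxb, hxa, hxb]
      · rw [Finset.sum_insert (by simp [hb])] at hsum
        rw [← Finset.add_sum_erase A _ ha]
        have h1 : ∀ x ∈ A.erase a, G.dist x (((Equiv.swap a b).trans σ) x) =
            G.dist x (σ x) := by
          intro x hx
          rw [Finset.mem_erase] at hx
          rw [Equiv.trans_apply, Equiv.swap_apply_of_ne_of_ne hx.1 (by rintro rfl; exact hb hx.2)]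
        have h2 : G.dist a (σ b) ≤ G.dist a b + G.dist b (σ b) := hG.dist_triangle
        rw [SimpleGraph.dist_eq_one_iff_adj.2 hab] at h2
        rw [Finset.sum_congr rfl h1, Equiv.trans_apply, Equiv.swap_apply_left]
        simp only [List.length_cons] at hsum ⊢
        omega

lemma Mstar_le_of_reconfIn (hG : G.Connected) {n : ℕ} (h : ReconfIn G n I J) :
    Mstar G I J ≤ n := by
  obtain ⟨S, ⟨-, hhead, hlast, -, hchain⟩, hlen⟩ := h
  obtain ⟨σ, hσ, hsum⟩ := exists_perm_of_isChain hG hchain hhead hlast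
  refine le_trans (Nat.sInf_le ⟨σ.subtypeEquiv hσ, rfl⟩) ?_
  rw [← hlen, len]
  refine le_trans (le_of_eq ?_) hsum
  exact Finset.sum_coe_sort I fun x => G.dist x (σ x)

lemma potential_le_Mstar (hT : G.IsTree) (v : V) (h : I.card = J.card) :
    potential G v I J ≤ Mstar G I J := by
  refine le_csInf ⟨_, Finset.equivOfCardEq h, rfl⟩ ?_
  rintro m ⟨e, rfl⟩
  exact potential_le_sum_dist hT e

end Sequences

section Spider

set_option linter.unusedSectionVars false

variable {G : SimpleGraph V} {v p c : V} {I J K : Finset V}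

lemma IsSpider.children_subsingleton (hS : IsSpider G v) (hp : p ≠ v) {d : V}
    (hc : c ∈ children G v p) (hd : d ∈ children G v p) : c = d := by
  by_contra hcd
  refine hp (hS.2.2 p ?_)
  obtain ⟨q, hq⟩ := exists_parent hS.1.connected hp
  rw [mem_children] at hc hd hq
  have hqc : q ≠ c := by rintro rfl; omega
  have hqd : q ≠ d := by rintro rfl; omega
  rw [← Set.ncard_eq_three.2 ⟨q, c, d, hqc, hqd, hcd, rfl⟩]
  refine Set.ncard_le_ncard ?_ (Set.toFinite _)
  rintro z (rfl | rfl | rfl)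
  exacts [hq.1.symm, hc.1, hd.1]

lemma IsSpider.flow_eq_of_mem_children (hS : IsSpider G v) (hp : p ≠ v)
    (hc : c ∈ children G v p) : flow G v I J p =
      (if p ∈ I then 1 else 0) - (if p ∈ J then 1 else 0) + flow G v I J c := by
  rw [flow_eq hS.1, Finset.sum_eq_single_of_mem c hc]
  exact fun d hd hdc => absurd (hS.children_subsingleton hp hd hc) hdc

lemma isIndep_slide (hI : IsIndep G I) {a b : V} (h : ∀ x ∈ I, x ≠ a → ¬ G.Adj b x) :
    IsIndep G (insert b (I.erase a)) := by
  have h' : ∀ x ∈ I.erase a, ¬ G.Adj b x := fun x hx =>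
    h x (Finset.mem_of_mem_erase hx) (Finset.ne_of_mem_erase hx)
  intro x hx y hy
  rcases Finset.mem_insert.1 hx with rfl | hx' <;> rcases Finset.mem_insert.1 hy with rfl | hy'
  · exact G.irrefl
  · exact h' y hy'
  · exact fun hadj => h' x hx' hadj.symm
  · exact hI x (Finset.mem_of_mem_erase hx') y (Finset.mem_of_mem_erase hy')

lemma exists_child_flow_neg (h : ∑ c ∈ children G v p, flow G v I J c < 0) :
    ∃ c ∈ children G v p, flow G v I J c < 0 := by
  by_contra! h'
  exact absurd (Finset.sum_nonneg h') (not_le.2 h)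

/-- If some token has to move away from the body, then one of those tokens can do so. -/
lemma IsSpider.exists_slide_down (hS : IsSpider G v) (hI : IsIndep G I) (hJ : IsIndep G J)
    (hp : p ∈ I) (hc : c ∈ children G v p) (hf : flow G v I J c < 0) :
    ∃ q ∈ I, ∃ d ∈ children G v q, d ∉ I ∧ flow G v I J d < 0 ∧
      IsIndep G (insert d (I.erase q)) ∧ (p ≠ v → q ≠ v) := by
  classical
  obtain ⟨q, hq, hmax⟩ := Finset.exists_max_image
    (I.filter fun q => ∃ d ∈ children G v q, flow G v I J d < 0) (G.dist v)
    ⟨p, by simpa [hp] using ⟨c, hc, hf⟩⟩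
  rw [Finset.mem_filter] at hq
  obtain ⟨hqI, d, hd, hfd⟩ := hq
  have hdI : d ∉ I := fun h => hI q hqI d h (mem_children.1 hd).1
  refine ⟨q, hqI, d, hd, hdI, hfd, isIndep_slide hI ?_, ?_⟩
  · intro x hx hxq hadj
    rcases mem_children_or_mem_children hS.1 v hadj with hxd | hdx
    · have e1 := hS.flow_eq_of_mem_children (I := I) (J := J) (ne_root_of_mem_children hd) hxd
      have e2 := flow_eq (v := v) hS.1 I J x
      have hJdx : ¬ (d ∈ J ∧ x ∈ J) := fun h => hJ d h.1 x h.2 hadj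
      obtain ⟨y, hy, hfy⟩ : ∃ y ∈ children G v x, flow G v I J y < 0 := by
        apply exists_child_flow_neg
        simp only [hdI, hx, if_true, if_false] at e1 e2
        by_cases h1 : d ∈ J <;> by_cases h2 : x ∈ J <;> (simp_all; try omega)
      have := hmax x (Finset.mem_filter.2 ⟨hx, y, hy, hfy⟩)
      have h1 := (mem_children.1 hxd).2
      have h2 := (mem_children.1 hd).2
      omega
    · exact hxq (parent_unique hS.1 hdx hd)
  · rintro hpv rfl
    have := hmax p (Finset.mem_filter.2 ⟨hp, c, hc, hf⟩)
    rw [SimpleGraph.dist_self, Nat.le_zero, hS.1.connected.dist_eq_zero_iff] at this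
    exact hpv this.symm

/-- Every leg contains as many tokens of `I` as of `J`. -/
def LegsBalanced (G : SimpleGraph V) (v : V) (I J : Finset V) : Prop :=
  ∀ w, G.Adj v w → flow G v I J w = 0

/-- The body has at most one neighbor in `I`. -/
def OneNearBody (G : SimpleGraph V) (v : V) (I : Finset V) : Prop :=
  ∀ x ∈ I, ∀ y ∈ I, G.Adj v x → G.Adj v y → x = y

/-- A slide towards `J` that changes the flow only over the edge along which it moves. -/
def GoodSlide (G : SimpleGraph V) (v : V) (I J K : Finset V) : Prop :=
  Slide G I K ∧ IsIndep G K ∧ potential G v K J + 1 = potential G v I J ∧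
    ∀ z, flow G v I J z = 0 → flow G v K J z = 0

lemma sum_natAbs_add_one {α : Type*} [Fintype α] [DecidableEq α] {f g : α → ℤ} {c : α}
    (hc : (g c).natAbs + 1 = (f c).natAbs) (h : ∀ z, z ≠ c → g z = f z) :
    ∑ z, (g z).natAbs + 1 = ∑ z, (f z).natAbs := by
  rw [← Finset.add_sum_erase _ _ (Finset.mem_univ c),
    ← Finset.add_sum_erase _ (fun z => (f z).natAbs) (Finset.mem_univ c), ← hc,
    Finset.sum_congr rfl fun z hz => by rw [h z (Finset.ne_of_mem_erase hz)]]
  ring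

lemma goodSlide_down (hT : G.IsTree) (hc : c ∈ children G v p) (hp : p ∈ I) (hcI : c ∉ I)
    (hf : flow G v I J c < 0) (hind : IsIndep G (insert c (I.erase p))) :
    GoodSlide G v I J (insert c (I.erase p)) := by
  have hflow := flow_slide_down hT I J hc hp hcI
  refine ⟨⟨p, hp, c, hcI, (mem_children.1 hc).1, rfl⟩, hind, ?_, fun z hz => ?_⟩
  · refine sum_natAbs_add_one (c := c) ?_ fun z hz => by simp [hflow, hz]
    rw [hflow, if_pos rfl]
    omega
  · rw [hflow, if_neg, hz, add_zero]
    rintro rfl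
    omega

lemma goodSlide_up (hT : G.IsTree) (hc : c ∈ children G v p) (hp : p ∉ I) (hcI : c ∈ I)
    (hf : 0 < flow G v I J c) (hind : IsIndep G (insert p (I.erase c))) :
    GoodSlide G v I J (insert p (I.erase c)) := by
  have hflow := flow_slide_up hT I J hc hp hcI
  refine ⟨⟨c, hcI, p, hp, (mem_children.1 hc).1.symm, rfl⟩, hind, ?_, fun z hz => ?_⟩
  · refine sum_natAbs_add_one (c := c) ?_ fun z hz => by simp [hflow, hz]
    rw [hflow, if_pos rfl]
    omega
  · rw [hflow, if_neg, hz, sub_zero]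
    rintro rfl
    omega

lemma IsSpider.exists_goodSlide_of_flow_neg (hS : IsSpider G v) (hI : IsIndep G I)
    (hJ : IsIndep G J) (hp : p ∈ I) (hc : c ∈ children G v p) (hf : flow G v I J c < 0) :
    ∃ K, GoodSlide G v I J K := by
  obtain ⟨q, hq, d, hd, hdI, hfd, hind, -⟩ := hS.exists_slide_down hI hJ hp hc hf
  exact ⟨_, goodSlide_down hS.1 hd hq hdI hfd hind⟩

lemma IsSpider.exists_goodSlide_of_flow_pos (hS : IsSpider G v) (hI : IsIndep G I)
    (hJ : IsIndep G J) (hcard : I.card = J.card)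
    (h : LegsBalanced G v I J ∨ OneNearBody G v I) {z : V} (hz : z ∈ I)
    (hf : 0 < flow G v I J z) : ∃ K, GoodSlide G v I J K := by
  obtain ⟨u, hu, hmin⟩ := Finset.exists_min_image
    (I.filter fun u => 0 < flow G v I J u) (G.dist v) ⟨z, by simp [hz, hf]⟩
  rw [Finset.mem_filter] at hu
  obtain ⟨huI, hfu⟩ := hu
  have hroot : flow G v I J v = 0 := flow_root hcard
  obtain ⟨p, hp⟩ := exists_parent hS.1.connected (u := u) (v := v) (by rintro rfl; omega)
  have hpI : p ∉ I := fun h => hI p h u huI (mem_children.1 hp).1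
  by_cases hblock : ∃ g ∈ I, p ∈ children G v g
  · obtain ⟨g, hg, hpg⟩ := hblock
    have hpv := ne_root_of_mem_children hpg
    have e1 := hS.flow_eq_of_mem_children (I := I) (J := J) hpv hp
    by_cases hgv : g = v
    · subst hgv
      by_cases hneg : ∃ w ∈ children G g g, flow G g I J w < 0
      · obtain ⟨w, hw, hfw⟩ := hneg
        exact hS.exists_goodSlide_of_flow_neg hI hJ hg hw hfw
      push Not at hneg
      have e2 := flow_eq (v := g) hS.1 I J g
      have h1 := Finset.single_le_sum hneg hpg
      have h2 : ¬ (g ∈ J ∧ p ∈ J) := fun h => hJ g h.1 p h.2 (mem_children.1 hpg).1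
      have h3 := hneg p hpg
      exfalso
      by_cases hgJ : g ∈ J <;> by_cases hpJ : p ∈ J <;> (simp_all; try omega)
    · have e2 := hS.flow_eq_of_mem_children (I := I) (J := J) hgv hpg
      have h2 : ¬ (g ∈ J ∧ p ∈ J) := fun h => hJ g h.1 p h.2 (mem_children.1 hpg).1
      have hfg : 0 < flow G v I J g := by
        by_cases hgJ : g ∈ J <;> by_cases hpJ : p ∈ J <;> (simp_all; try omega)
      have := hmin g (Finset.mem_filter.2 ⟨hg, hfg⟩)
      have h3 := (mem_children.1 hpg).2
      have h4 := (mem_children.1 hp).2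
      omega
  · refine ⟨_, goodSlide_up hS.1 hp hpI huI hfu (isIndep_slide hI ?_)⟩
    intro x hx hxu hadj
    rcases mem_children_or_mem_children hS.1 v hadj with hxp | hpx
    · by_cases hpv : p = v
      · subst hpv
        rw [mem_children_root] at hxp hp
        rcases h with h | h
        · exact hfu.ne' (h u hp)
        · exact hxu (h x hx u huI hxp hp)
      · exact hxu (hS.children_subsingleton hpv hxp hp)
    · exact hblock ⟨x, hx, hpx⟩

lemma IsSpider.exists_goodSlide (hS : IsSpider G v) (hI : IsIndep G I)
    (hJ : IsIndep G J) (hcard : I.card = J.card)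
    (h : LegsBalanced G v I J ∨ OneNearBody G v I) (hpot : potential G v I J ≠ 0) :
    ∃ K, GoodSlide G v I J K := by
  have hroot : flow G v I J v = 0 := flow_root hcard
  by_cases hpos : ∃ z, 0 < flow G v I J z
  · obtain ⟨z, hz, hmax⟩ := Finset.exists_max_image
      (Finset.univ.filter fun z => 0 < flow G v I J z) (G.dist v)
      (by obtain ⟨z, hz⟩ := hpos; exact ⟨z, by simp [hz]⟩)
    simp only [Finset.mem_filter, Finset.mem_univ, true_and] at hz hmax
    have hsum : ∑ c ∈ children G v z, flow G v I J c ≤ 0 := by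
      refine Finset.sum_nonpos fun c hc => ?_
      by_contra! hfc
      have h1 := hmax c hfc
      have h2 := (mem_children.1 hc).2
      omega
    have e := flow_eq (v := v) hS.1 I J z
    have hzI : z ∈ I := by
      by_contra hzI
      by_cases hzJ : z ∈ J <;> simp only [hzI, hzJ, if_true, if_false] at e <;> omega
    exact hS.exists_goodSlide_of_flow_pos hI hJ hcard h hzI hz
  · push Not at hpos
    obtain ⟨z, hz, hmin⟩ := Finset.exists_min_image
      (Finset.univ.filter fun z => flow G v I J z < 0) (G.dist v) (by
        by_contra hempty
        refine hpot (Finset.sum_eq_zero fun z _ => ?_)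
        have h1 := hpos z
        have h2 : ¬ flow G v I J z < 0 := fun h => hempty ⟨z, by simp [h]⟩
        omega)
    simp only [Finset.mem_filter, Finset.mem_univ, true_and] at hz hmin
    obtain ⟨p, hp⟩ := exists_parent hS.1.connected (u := z) (v := v) (by rintro rfl; omega)
    have hfp : 0 ≤ flow G v I J p := by
      by_contra! hfp
      have h1 := hmin p hfp
      have h2 := (mem_children.1 hp).2
      omega
    have hsum : ∑ c ∈ children G v p, flow G v I J c < 0 :=
      Finset.sum_neg' (fun c _ => hpos c) ⟨z, hp, hz⟩
    have e := flow_eq (v := v) hS.1 I J p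
    have hpI : p ∈ I := by
      by_contra hpI
      by_cases hpJ : p ∈ J <;> simp only [hpI, hpJ, if_true, if_false] at e <;> omega
    exact hS.exists_goodSlide_of_flow_neg hI hJ hpI hp hz

/-- Either all legs are balanced, or the body has at most one neighbor in each of `I` and `J`
and no such neighbor blocks a balanced leg on both sides. -/
def Unobstructed (G : SimpleGraph V) (v : V) (I J : Finset V) : Prop :=
  LegsBalanced G v I J ∨ (OneNearBody G v I ∧ OneNearBody G v J ∧
    ∀ w, G.Adj v w → w ∈ I → w ∈ J → flow G v I J w ≠ 0)

lemma LegsBalanced.symm (h : LegsBalanced G v I J) : LegsBalanced G v J I := fun w hw => by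
  rw [flow_swap, h w hw, neg_zero]

lemma Unobstructed.symm (h : Unobstructed G v I J) : Unobstructed G v J I := by
  rcases h with h | ⟨h1, h2, h3⟩
  · exact Or.inl h.symm
  · refine Or.inr ⟨h2, h1, fun w hw hwJ hwI => ?_⟩
    rw [flow_swap, neg_ne_zero]
    exact h3 w hw hwI hwJ

lemma IsSpider.exists_goodSlide_near_body (hS : IsSpider G v) (hI : IsIndep G I)
    (hJ : IsIndep G J) (h1 : OneNearBody G v I) (h2 : OneNearBody G v J)
    (h3 : ∀ w, G.Adj v w → w ∈ I → w ∈ J → flow G v I J w ≠ 0) {x : V} (hx : x ∈ I)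
    (hvx : G.Adj v x) : ∃ K, GoodSlide G v I J K ∧ Unobstructed G v K J := by
  have hxv : x ∈ children G v v := mem_children_root.2 hvx
  rcases lt_or_ge 0 (flow G v I J x) with hf | hf
  · have hv : v ∉ I := fun h => hI v h x hx hvx
    refine ⟨_, goodSlide_up hS.1 hxv hv hx hf
      (isIndep_slide hI fun y hy hyx hvy => hyx (h1 y hy x hx hvy hvx)), Or.inr ?_⟩
    have hnone : ∀ y ∈ insert v (I.erase x), ¬ G.Adj v y := by
      intro y hy hvy
      rcases Finset.mem_insert.1 hy with rfl | hy
      · exact G.irrefl hvy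
      · exact Finset.ne_of_mem_erase hy (h1 y (Finset.mem_of_mem_erase hy) x hx hvy hvx)
    exact ⟨fun y hy _ _ hvy => absurd hvy (hnone y hy), h2,
      fun w hw hwK => absurd hw (hnone w hwK)⟩
  · have e := flow_eq (v := v) hS.1 I J x
    have h3x := h3 x hvx hx
    obtain ⟨c, hc, hfc⟩ : ∃ c ∈ children G v x, flow G v I J c < 0 := by
      apply exists_child_flow_neg
      by_cases hxJ : x ∈ J
      · have := h3x hxJ
        simp only [hx, hxJ, if_true] at e
        omega
      · simp only [hx, hxJ, if_true, if_false] at e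
        omega
    obtain ⟨q, hq, d, hd, hdI, hfd, hind, hqv⟩ := hS.exists_slide_down hI hJ hx hc hfc
    have hdv : ¬ G.Adj v d := fun h =>
      hqv (ne_root_of_mem_children hxv) (parent_unique hS.1 hd (mem_children_root.2 h))
    refine ⟨_, goodSlide_down hS.1 hd hq hdI hfd hind, Or.inr ?_⟩
    have hmem : ∀ y ∈ insert d (I.erase q), G.Adj v y → y ∈ I := by
      intro y hy hvy
      rcases Finset.mem_insert.1 hy with rfl | hy
      · exact absurd hvy hdv
      · exact Finset.mem_of_mem_erase hy
    refine ⟨fun y hy z hz hvy hvz => h1 y (hmem y hy hvy) z (hmem z hz hvz) hvy hvz, h2,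
      fun w hw hwK hwJ => ?_⟩
    rw [flow_slide_down hS.1 I J hd hq hdI, if_neg (by rintro rfl; exact hdv hw), add_zero]
    exact h3 w hw (hmem w hwK hw) hwJ

lemma IsSpider.exists_goodSlide_unobstructed (hS : IsSpider G v) (hI : IsIndep G I)
    (hJ : IsIndep G J) (hcard : I.card = J.card) (h : Unobstructed G v I J)
    (hpot : potential G v I J ≠ 0) :
    (∃ K, GoodSlide G v I J K ∧ Unobstructed G v K J) ∨
      ∃ K, GoodSlide G v J I K ∧ Unobstructed G v K I := by
  rcases h with h | ⟨h1, h2, h3⟩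
  · obtain ⟨K, hK⟩ := hS.exists_goodSlide hI hJ hcard (Or.inl h) hpot
    exact Or.inl ⟨K, hK, Or.inl fun w hw => hK.2.2.2 w (h w hw)⟩
  by_cases hIv : ∃ x ∈ I, G.Adj v x
  · obtain ⟨x, hx, hvx⟩ := hIv
    exact Or.inl (hS.exists_goodSlide_near_body hI hJ h1 h2 h3 hx hvx)
  by_cases hJv : ∃ y ∈ J, G.Adj v y
  · obtain ⟨y, hy, hvy⟩ := hJv
    refine Or.inr (hS.exists_goodSlide_near_body hJ hI h2 h1 (fun w hw hwJ hwI => ?_) hy hvy)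
    rw [flow_swap, neg_ne_zero]
    exact h3 w hw hwI hwJ
  push Not at hIv hJv
  obtain ⟨K, hK⟩ := hS.exists_goodSlide hI hJ hcard (Or.inr h1) hpot
  refine Or.inl ⟨K, hK, Or.inr ⟨?_, h2, fun w hw _ hwJ => absurd hw (hJv w hwJ)⟩⟩
  obtain ⟨a, -, b, -, -, rfl⟩ := hK.1
  have hmem : ∀ y ∈ insert b (I.erase a), G.Adj v y → y = b := by
    intro y hy hvy
    rcases Finset.mem_insert.1 hy with rfl | hy
    · rfl
    · exact absurd hvy (hIv y (Finset.mem_of_mem_erase hy))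
  exact fun x hx y hy hvx hvy => (hmem x hx hvx).trans (hmem y hy hvy).symm

lemma IsSpider.reconfIn_potential (hS : IsSpider G v) (hI : IsIndep G I) (hJ : IsIndep G J)
    (hcard : I.card = J.card) (h : Unobstructed G v I J) :
    ReconfIn G (potential G v I J) I J := by
  induction hn : potential G v I J generalizing I J with
  | zero =>
    obtain rfl := eq_of_potential_eq_zero hS.1 hn
    exact ReconfIn.refl hI
  | succ n ih =>
    rcases hS.exists_goodSlide_unobstructed hI hJ hcard h (by omega) with
      ⟨K, ⟨hslide, hK, hpot, -⟩, hU⟩ | ⟨K, ⟨hslide, hK, hpot, -⟩, hU⟩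
    · exact (ih hK hJ (hslide.card_eq.trans hcard) hU (by omega)).cons hI hslide
    · rw [potential_comm, potential_comm I J] at hpot
      exact (ih hI hK (hcard.trans hslide.card_eq.symm) hU.symm (by omega)).concat hJ hslide.symm

lemma mem_side_iff_mem_ancestors (hG : G.Connected) {w z : V} (hw : G.Adj v w) :
    z ∈ side G v w ↔ w ∈ ancestors G v z := by
  have h1 := SimpleGraph.dist_eq_one_iff_adj.2 hw
  have h2 : G.dist v z ≤ G.dist v w + G.dist w z := hG.dist_triangle
  rw [side, Set.mem_ofPred_eq, mem_ancestors, SimpleGraph.dist_comm (u := z),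
    SimpleGraph.dist_comm (u := z) (v := v)]
  omega

lemma legCard_eq_load (hG : G.Connected) (I : Finset V) {w : V} (hw : G.Adj v w) :
    (legCard G I v w : ℤ) = load G v I w := by
  have : (I : Set V) ∩ side G v w = (I.filter fun z => w ∈ ancestors G v z : Finset V) := by
    ext z
    simp [mem_side_iff_mem_ancestors hG hw]
  rw [legCard, this, Set.ncard_coe_finset, load, Finset.sum_boole]

lemma oneNearBody_of_ncard_le (h : ((I : Set V) ∩ G.neighborSet v).ncard ≤ 1) :
    OneNearBody G v I := fun x hx y hy hvx hvy =>
  (Set.ncard_le_one (Set.toFinite _)).1 h x ⟨hx, hvx⟩ y ⟨hy, hvy⟩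

lemma OneNearBody.inter_eq (h : OneNearBody G v I) {x : V} (hx : x ∈ I) (hvx : G.Adj v x) :
    (I : Set V) ∩ G.neighborSet v = {x} := by
  ext y
  constructor
  · rintro ⟨hy, hvy⟩
    exact h y hy x hx hvy hvx
  · rintro rfl
    exact ⟨hx, hvx⟩

lemma ILegCard_eq_legCard (hv : v ∉ I) (w₁ w : V) : ILegCard G I v w₁ w = legCard G I v w := by
  have : (I : Set V) ∩ {v} = ∅ := by simpa using hv
  rw [ILegCard, ILeg, legCard, this, ite_self, Set.union_empty]

end Spider

/-- Lemma 6(ii) of the paper. Suppose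
`0 < max{|I ∩ N(v)|, |J ∩ N(v)|} ≤ 1`, some leg has `|I_L| ≠ |J_L|`, and it is
NOT the case that `I ∩ N(v) = {x}` and `J ∩ N(v) = {y}` with `x` and `y` in the
same leg `L` with `|I_L| = |J_L|`. Then there is a TS-sequence between `I` and
`J` of length exactly `M*(G,I,J)`. -/
theorem spider_one_token_near_body_no_detour
    {V : Type*} [Fintype V] [DecidableEq V] (G : SimpleGraph V) (v : V)
    (hG : IsSpider G v) (I J : Finset V)
    (hI : IsIndep G I) (hJ : IsIndep G J) (hcard : I.card = J.card)
    (hreconf : Reconf G I J)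
    (hIrigid : ∀ u ∈ I, ¬ RigidToken G I u)
    (hJrigid : ∀ u ∈ J, ¬ RigidToken G J u)
    (hpos : 0 < max (((I : Set V) ∩ G.neighborSet v).ncard)
      (((J : Set V) ∩ G.neighborSet v).ncard))
    (hle : max (((I : Set V) ∩ G.neighborSet v).ncard)
      (((J : Set V) ∩ G.neighborSet v).ncard) ≤ 1)
    (w₁ : V) (hw₁ : IsFirstLeg G I J v w₁)
    (hleg : ∃ w, G.Adj v w ∧ ILegCard G I v w₁ w ≠ ILegCard G J v w₁ w)
    (hnot : ¬ ∃ x y w, (I : Set V) ∩ G.neighborSet v = {x} ∧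
      (J : Set V) ∩ G.neighborSet v = {y} ∧ G.Adj v w ∧
      x ∈ side G v w ∧ y ∈ side G v w ∧
      ILegCard G I v w₁ w = ILegCard G J v w₁ w) :
    ∃ S, IsTSSeq G I J S ∧ len S = Mstar G I J := by
  have hG' := hG.1.connected
  have h1 : OneNearBody G v I := oneNearBody_of_ncard_le (le_trans (le_max_left _ _) hle)
  have h2 : OneNearBody G v J := oneNearBody_of_ncard_le (le_trans (le_max_right _ _) hle)
  have hU : Unobstructed G v I J := by
    refine Or.inr ⟨h1, h2, fun w hw hwI hwJ hf => hnot ?_⟩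
    have hside : w ∈ side G v w :=
      (mem_side_iff_mem_ancestors hG' hw).2 (mem_ancestors.2 (by simp))
    refine ⟨w, w, w, h1.inter_eq hwI hw, h2.inter_eq hwJ hw, hw, hside, hside, ?_⟩
    rw [ILegCard_eq_legCard fun h => hI v h w hwI hw,
      ILegCard_eq_legCard fun h => hJ v h w hwJ hw]
    zify
    rw [legCard_eq_load hG' I hw, legCard_eq_load hG' J hw]
    exact sub_eq_zero.1 hf
  have hR := hG.reconfIn_potential hI hJ hcard hU
  obtain ⟨S, hS, hlen⟩ := id hR
  exact ⟨S, hS, hlen.trans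
    (le_antisymm (potential_le_Mstar hG.1 v hcard) (Mstar_le_of_reconfIn hG' hR))⟩

end SlidingTokenPaper
end

section
/- Let G be a spider with body v, and let I and J be independent sets of G with |I| = |J| such that I ↭ J. Suppose that some leg K of G satisfies |I ∩ V(K)| > |J ∩ V(K)|, that I ∩ N(v) = {x} and J ∩ N(v) = {y}, and that x and y lie in the same leg L of G with |I_L| = |J_L| (so that x = y). If x has a neighbor v′ ≠ v in G, then every TS-sequence between I and J makes a detour over the edge xv or over the edge xv′; if v is the only neighbor of x, then every TS-sequence between I and J makes a detour over the edge xv. -/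
/-!
Common definitions for formalizing "Shortest Reconfiguration Sequence for
Sliding Tokens on Spiders" (Hoang, Khorramian, Uehara).
-/

namespace SlidingTokenPaper

variable {V : Type*} [Fintype V] [DecidableEq V]

omit [Fintype V] in
lemma moveCount_cons_cons (A B : Finset V) (T : List (Finset V)) (a b : V) :
    moveCount (A :: B :: T) a b =
      (if A \ B = {a} ∧ B \ A = {b} then 1 else 0) + moveCount (B :: T) a b := by
  unfold moveCount
  simp only [List.tail_cons, List.zip_cons_cons, List.filter_cons]
  split_ifs <;> simp_all [Nat.add_comm]

omit [Fintype V] in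
lemma exists_mem_of_moveCount_pos {a b : V} :
    ∀ {S : List (Finset V)}, 0 < moveCount S a b → ∃ B ∈ S, b ∈ B
  | [], h => by simp [moveCount] at h
  | [A], h => by simp [moveCount] at h
  | A :: B :: T, h => by
    rw [moveCount_cons_cons] at h
    split_ifs at h with hc
    · have hb : b ∈ B \ A := by simp [hc.2]
      exact ⟨B, by simp, (Finset.mem_sdiff.1 hb).1⟩
    · obtain ⟨C, hC, hb⟩ := exists_mem_of_moveCount_pos (S := B :: T) (by simpa using h)
      exact ⟨C, List.mem_cons_of_mem _ hC, hb⟩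

omit [Fintype V] in
/-- A token that is on `x` at the start and is later absent from `x` slides out of `x`. -/
lemma exists_move_out {G : SimpleGraph V} {x : V} {B : Finset V} (hxB : x ∉ B) :
    ∀ {S : List (Finset V)} {A : Finset V}, S.IsChain (Step G) → S.head? = some A → x ∈ A →
      B ∈ S → ∃ z, G.Adj x z ∧ 0 < moveCount S x z
  | [], _, _, h, _, _ => by simp at h
  | [C], A, _, h, hxA, hB => by simp_all
  | C :: D :: T, A, hS, h, hxA, hB => by
    obtain rfl : C = A := by simpa using h
    obtain ⟨hstep, hT⟩ := List.isChain_cons_cons.1 hS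
    simp only [moveCount_cons_cons]
    by_cases hxD : x ∈ D
    · have hBT : B ∈ D :: T := by
        rcases List.mem_cons.1 hB with rfl | hB
        · exact absurd hxA hxB
        · exact hB
      obtain ⟨z, hz, hpos⟩ := exists_move_out hxB hT rfl hxD hBT
      exact ⟨z, hz, by omega⟩
    · obtain ⟨a, b, hab, h₁, h₂⟩ := hstep
      have hxa : x ∈ C \ D := Finset.mem_sdiff.2 ⟨hxA, hxD⟩
      obtain rfl : x = a := by simpa [h₁] using hxa
      exact ⟨b, hab, by rw [if_pos ⟨h₁, h₂⟩]; omega⟩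

omit [Fintype V] in
/-- If `x` carries no token at some moment but carries one at the end, a token slides into `x`. -/
lemma exists_move_in {G : SimpleGraph V} {x : V} {J : Finset V} (hxJ : x ∈ J) :
    ∀ {S : List (Finset V)} {B : Finset V}, S.IsChain (Step G) → S.getLast? = some J →
      B ∈ S → x ∉ B → ∃ z, G.Adj x z ∧ 0 < moveCount S z x
  | [], _, _, h, _, _ => by simp at h
  | [C], B, _, h, hB, hxB => by simp_all
  | C :: D :: T, B, hS, h, hB, hxB => by
    obtain ⟨hstep, hT⟩ := List.isChain_cons_cons.1 hS
    rw [List.getLast?_cons_cons] at h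
    simp only [moveCount_cons_cons]
    by_cases hcross : x ∉ C ∧ x ∈ D
    · obtain ⟨a, b, hab, h₁, h₂⟩ := hstep
      have hxb : x ∈ D \ C := Finset.mem_sdiff.2 ⟨hcross.2, hcross.1⟩
      obtain rfl : x = b := by simpa [h₂] using hxb
      exact ⟨a, hab.symm, by rw [if_pos ⟨h₁, h₂⟩]; omega⟩
    · have hlater : ∃ B' ∈ D :: T, x ∉ B' := by
        rcases List.mem_cons.1 hB with rfl | hB
        · exact ⟨D, by simp, fun hxD => hcross ⟨hxB, hxD⟩⟩
        · exact ⟨B, hB, hxB⟩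
      obtain ⟨B', hB', hxB'⟩ := hlater
      obtain ⟨z, hz, hpos⟩ := exists_move_in hxJ hT h hB' hxB'
      exact ⟨z, hz, by omega⟩

omit [Fintype V] in
/-- Token balance of one slide, for a set `P` that is left only along the edge `pq`. -/
lemma Step.ncard_inter_balance {G : SimpleGraph V} {P : Set V} {p q : V} (hp : p ∈ P) (hq : q ∉ P)
    (hP : ∀ a b, G.Adj a b → a ∈ P → b ∉ P → a = p ∧ b = q) {A B : Finset V} (h : Step G A B) :
    ((A : Set V) ∩ P).ncard + (if A \ B = {q} ∧ B \ A = {p} then 1 else 0) =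
      ((B : Set V) ∩ P).ncard + (if A \ B = {p} ∧ B \ A = {q} then 1 else 0) := by
  classical
  obtain ⟨a, b, hab, h₁, h₂⟩ := h
  have hcount : ∀ C : Finset V, ((C : Set V) ∩ P).ncard = (C.filter (· ∈ P)).card := fun C => by
    rw [← Set.ncard_coe_finset]
    congr 1
    ext z
    simp
  have hsplit : ∀ C D : Finset V,
      (C.filter (· ∈ P)).card =
        ((C \ D).filter (· ∈ P)).card + ((C ∩ D).filter (· ∈ P)).card := fun C D => by
    rw [← Finset.card_union_of_disjoint, ← Finset.filter_union, Finset.sdiff_union_inter]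
    exact Finset.disjoint_filter_filter (Finset.disjoint_sdiff_inter C D)
  rw [hcount, hcount, hsplit A B, hsplit B A, Finset.inter_comm B A, h₁, h₂,
    Finset.filter_singleton, Finset.filter_singleton]
  simp only [Finset.singleton_inj]
  have hpq : p ≠ q := fun e => hq (e ▸ hp)
  by_cases ha : a ∈ P <;> by_cases hb : b ∈ P
  · have h₃ : ¬ (a = q ∧ b = p) := fun e => hq (e.1 ▸ ha)
    have h₄ : ¬ (a = p ∧ b = q) := fun e => hq (e.2 ▸ hb)
    simp [ha, hb, h₃, h₄]
  · obtain ⟨rfl, rfl⟩ := hP a b hab ha hb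
    simp [ha, hb, hpq]
    omega
  · obtain ⟨rfl, rfl⟩ := hP b a hab.symm hb ha
    simp [ha, hb, hpq]
    omega
  · have h₃ : ¬ (a = q ∧ b = p) := fun e => hb (e.2 ▸ hp)
    have h₄ : ¬ (a = p ∧ b = q) := fun e => ha (e.1 ▸ hp)
    simp [ha, hb, h₃, h₄]

omit [Fintype V] in
/-- Token balance of a whole sequence of slides. -/
lemma ncard_inter_balance {G : SimpleGraph V} {P : Set V} {p q : V} (hp : p ∈ P) (hq : q ∉ P)
    (hP : ∀ a b, G.Adj a b → a ∈ P → b ∉ P → a = p ∧ b = q) {J : Finset V} :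
    ∀ {S : List (Finset V)} {I : Finset V}, S.IsChain (Step G) → S.head? = some I →
      S.getLast? = some J →
      ((I : Set V) ∩ P).ncard + moveCount S q p = ((J : Set V) ∩ P).ncard + moveCount S p q
  | [], _, _, h, _ => by simp at h
  | [C], I, _, h, hl => by
    obtain rfl : C = I := by simpa using h
    obtain rfl : C = J := by simpa using hl
    simp [moveCount]
  | C :: D :: T, I, hS, h, hl => by
    obtain rfl : C = I := by simpa using h
    obtain ⟨hstep, hT⟩ := List.isChain_cons_cons.1 hS
    rw [List.getLast?_cons_cons] at hl
    have ih := ncard_inter_balance hp hq hP hT rfl hl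
    have hb := hstep.ncard_inter_balance hp hq hP
    rw [moveCount_cons_cons, moveCount_cons_cons]
    omega

omit [Fintype V] in
/-- In a tree, `side G q p` is left only along the edge `pq`. -/
lemma eq_of_adj_of_mem_side {G : SimpleGraph V} (hG : G.IsTree) {p q : V} (hpq : G.Adj p q)
    {a b : V} (hab : G.Adj a b) (ha : a ∈ side G q p) (hb : b ∉ side G q p) :
    a = p ∧ b = q := by
  have hbr := SimpleGraph.isAcyclic_iff_forall_adj_isBridge.1 hG.isAcyclic hpq
  rw [SimpleGraph.isBridge_iff_forall_walk_mem_edges] at hbr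
  simp only [side, Set.mem_ofPred_eq, not_lt] at ha hb
  obtain ⟨r, hr⟩ := hG.connected.exists_walk_length_eq_dist a p
  obtain ⟨s, hs⟩ := hG.connected.exists_walk_length_eq_dist b q
  have hrq : q ∉ r.support := fun hmem => by
    have h₁ := r.length_takeUntil_le_length hmem
    have h₂ := SimpleGraph.dist_le (r.takeUntil q hmem)
    omega
  have hsp : p ∉ s.support := fun hmem => by
    have h₁ := s.length_takeUntil_lt_length hmem hpq.ne
    have h₂ := SimpleGraph.dist_le (s.takeUntil p hmem)
    omega
  have hmem := hbr (r.reverse.append (.cons hab s))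
  simp only [SimpleGraph.Walk.edges_append, SimpleGraph.Walk.edges_reverse,
    SimpleGraph.Walk.edges_cons, List.mem_append, List.mem_reverse, List.mem_cons] at hmem
  rcases hmem with h | h | h
  · exact absurd (r.snd_mem_support_of_mem_edges h) hrq
  · rcases Sym2.eq_iff.1 h with ⟨h₁, h₂⟩ | ⟨h₁, h₂⟩
    · exact ⟨h₁.symm, h₂.symm⟩
    · subst h₂
      simp at ha
  · exact absurd (s.fst_mem_support_of_mem_edges h) hsp

omit [Fintype V] [DecidableEq V] in
lemma right_mem_side {G : SimpleGraph V} {p q : V} (hpq : G.Adj p q) : p ∈ side G q p := by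
  simp [side, SimpleGraph.dist_eq_one_iff_adj.2 hpq]

omit [Fintype V] [DecidableEq V] in
lemma left_notMem_side (G : SimpleGraph V) (p q : V) : q ∉ side G q p := by
  simp [side]

omit [Fintype V] [DecidableEq V] in
lemma eq_of_adj_of_mem_side_of_adj {G : SimpleGraph V} (hG : G.Connected) {v w z : V}
    (hvz : G.Adj v z) (hz : z ∈ side G v w) : z = w := by
  have h₁ : G.dist z v = 1 := SimpleGraph.dist_eq_one_iff_adj.2 hvz.symm
  simp only [side, Set.mem_ofPred_eq, h₁, Nat.lt_one_iff] at hz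
  exact hG.dist_eq_zero_iff.1 hz

omit [Fintype V] in
/-- Core of the argument: the moves over `xv` are balanced, and some slide leaves `x` and some
slide enters `x`. -/
lemma moves_at_unique_neighbor {G : SimpleGraph V} {v : V} (hG : G.IsTree) {I J : Finset V}
    (hI : IsIndep G I) (hJ : IsIndep G J)
    (hK : ∃ w, G.Adj v w ∧
      ((J : Set V) ∩ side G v w).ncard < ((I : Set V) ∩ side G v w).ncard)
    {x y : V} (hx : (I : Set V) ∩ G.neighborSet v = {x})
    (hy : (J : Set V) ∩ G.neighborSet v = {y}) {w₁ w : V}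
    (hxw : x ∈ side G v w) (hyw : y ∈ side G v w)
    (hbal : ILegCard G I v w₁ w = ILegCard G J v w₁ w)
    {S : List (Finset V)} (hS : IsTSSeq G I J S) :
    G.Adj x v ∧ moveCount S v x = moveCount S x v ∧
      (∃ z, G.Adj x z ∧ 0 < moveCount S x z) ∧ ∃ z, G.Adj x z ∧ 0 < moveCount S z x := by
  obtain ⟨hxI, hvx⟩ : x ∈ (I : Set V) ∩ G.neighborSet v := by simp [hx]
  obtain ⟨hyJ, hvy⟩ : y ∈ (J : Set V) ∩ G.neighborSet v := by simp [hy]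
  rw [Finset.mem_coe] at hxI hyJ
  rw [SimpleGraph.mem_neighborSet] at hvx hvy
  obtain rfl := eq_of_adj_of_mem_side_of_adj hG.connected hvx hxw
  obtain rfl := eq_of_adj_of_mem_side_of_adj hG.connected hvy hyw
  have hvI : v ∉ I := fun h => hI _ h _ hxI hvx
  have hvJ : v ∉ J := fun h => hJ _ h _ hyJ hvx
  have hleg : ∀ C : Finset V, v ∉ C → ILegCard G C v w₁ y = ((C : Set V) ∩ side G v y).ncard :=
    fun C hC => by
      unfold ILegCard ILeg
      split_ifs
      · rw [Set.inter_singleton_eq_empty.2 (by simpa using hC), Set.union_empty]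
      · rw [Set.union_empty]
  rw [hleg I hvI, hleg J hvJ] at hbal
  obtain ⟨-, hhead, hlast, hind, hchain⟩ := hS
  have hflow : ∀ k, G.Adj v k → ((I : Set V) ∩ side G v k).ncard + moveCount S v k =
      ((J : Set V) ∩ side G v k).ncard + moveCount S k v := fun k hk =>
    ncard_inter_balance (right_mem_side hk.symm) (left_notMem_side G k v)
      (fun a b => eq_of_adj_of_mem_side hG hk.symm) hchain hhead hlast
  obtain ⟨k, hvk, hlt⟩ := hK
  have hkv : 0 < moveCount S k v := by have := hflow k hvk; omega
  obtain ⟨B, hB, hvB⟩ := exists_mem_of_moveCount_pos hkv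
  have hxB : y ∉ B := fun h => (hind B hB).1 _ hvB _ h hvx
  refine ⟨hvx.symm, ?_, exists_move_out hxB hchain hhead hxI hB,
    exists_move_in hyJ hchain hlast hB hxB⟩
  have := hflow y hvx
  omega

/-- heart of Lemma 6(i). Suppose some leg `K` has
`|I ∩ V(K)| > |J ∩ V(K)|`, `I ∩ N(v) = {x}`, `J ∩ N(v) = {y}`, and `x, y` lie in
the same leg `L` with `|I_L| = |J_L|`. If `x` has a neighbor `v' ≠ v`, every
TS-sequence between `I` and `J` makes a detour over `xv` or over `xv'`; if `v`
is the only neighbor of `x`, every TS-sequence makes a detour over `xv`. -/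
theorem spider_forced_detour_edges
    {V : Type*} [Fintype V] [DecidableEq V] (G : SimpleGraph V) (v : V)
    (hG : IsSpider G v) (I J : Finset V)
    (hI : IsIndep G I) (hJ : IsIndep G J) (hcard : I.card = J.card)
    (hreconf : Reconf G I J)
    (hK : ∃ w, G.Adj v w ∧
      ((J : Set V) ∩ side G v w).ncard < ((I : Set V) ∩ side G v w).ncard)
    (x y : V)
    (hx : (I : Set V) ∩ G.neighborSet v = {x})
    (hy : (J : Set V) ∩ G.neighborSet v = {y})
    (w₁ : V) (hw₁ : IsFirstLeg G I J v w₁)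
    (hsame : ∃ w, G.Adj v w ∧ x ∈ side G v w ∧ y ∈ side G v w ∧
      ILegCard G I v w₁ w = ILegCard G J v w₁ w) :
    (∀ v', G.Adj x v' → v' ≠ v →
      ∀ S, IsTSSeq G I J S → MakesDetour S x v ∨ MakesDetour S x v') ∧
    (G.neighborSet x = {v} →
      ∀ S, IsTSSeq G I J S → MakesDetour S x v) := by
  obtain ⟨w, -, hxw, hyw, hbal⟩ := hsame
  have key := fun S (hS : IsTSSeq G I J S) =>
    moves_at_unique_neighbor hG.1 hI hJ hK hx hy hxw hyw hbal hS
  refine ⟨fun v' hv' hne S hS => ?_, fun hleaf S hS => ?_⟩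
  · obtain ⟨hxv, heq, ⟨z, hz, hout⟩, t, ht, hin⟩ := key S hS
    have hnbr : ∀ u, G.Adj x u → u = v ∨ u = v' := fun u hu => by
      by_contra! hcon
      refine hxv.ne (hG.2.2 x ?_)
      have hsub : ({u, v, v'} : Set V) ⊆ G.neighborSet x := by
        rintro _ (rfl | rfl | rfl) <;> assumption
      calc 3 = ({u, v, v'} : Set V).ncard :=
            (Set.ncard_eq_three.2 ⟨u, v, v', hcon.1, hcon.2, hne.symm, rfl⟩).symm
        _ ≤ _ := Set.ncard_le_ncard hsub (Set.toFinite _)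
    unfold MakesDetour
    rcases hnbr z hz with rfl | rfl
    · exact .inl ⟨hout, by omega⟩
    · rcases hnbr t ht with rfl | rfl
      · exact .inl ⟨by omega, hin⟩
      · exact .inr ⟨hout, hin⟩
  · obtain ⟨-, heq, ⟨z, hz, hout⟩, -⟩ := key S hS
    obtain rfl : z = v := by
      rw [← SimpleGraph.mem_neighborSet, hleaf] at hz
      exact hz
    exact ⟨hout, by omega⟩

end SlidingTokenPaper
end
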